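/- Let p>2, let N≥1 be an integer, let h∈C([0,1],ℝ) satisfy: for every r∈[0,1], S_p(h)'(r)=0 implies h(r)≠0, and let h̄∈C([0,1],ℝ). Set u:=S_p(h) (so that |u'|^{2−p}∈L^1(0,1)) and define v(r):=p* ∫_r^1 |u'(s)|^{2−p} J(h̄)(s) ds for r∈[0,1]. Then: (a) v(1)=0; (b) at every r∈(0,1] with u'(r)≠0, v is differentiable with v'(r)=−p*|u'(r)|^{2−p}J(h̄)(r), and there r^{N−1}|u'(r)|^{p−2}v'(r) = −p* ∫_0^r t^{N−1}h̄(t)dt; consequently the function r↦r^{N−1}|u'(r)|^{p−2}v'(r) extends to a C^1 function w on [0,1] satisfying −w'(r)=p* r^{N−1} h̄(r); (c) there exist ρ>0 and C>0 such that u'(r)≠0 for all r∈(0,ρ] and |v'(r)|≤C r^{p*} for r∈(0,ρ]; hence v is differentiable at 0 with v'(0)=0. -/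

import Mathlib

open Set MeasureTheory Filter Topology intervalIntegral

noncomputable section

/-- `phi p ξ = |ξ|^(p-2) ξ`, the function `φ_p`. -/
def phi (p ξ : ℝ) : ℝ := |ξ| ^ (p - 2) * ξ

/-- The (one-sided at endpoints) derivative of a function on `[0,1]`. -/
def deriv01 (u : ℝ → ℝ) (r : ℝ) : ℝ := derivWithin u (Set.Icc 0 1) r

/-- `u ∈ C^1([0,1],ℝ)`. -/
def C1on01 (u : ℝ → ℝ) : Prop :=
  (∀ r ∈ Set.Icc (0:ℝ) 1, DifferentiableWithinAt ℝ u (Set.Icc 0 1) r) ∧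
  ContinuousOn (deriv01 u) (Set.Icc 0 1)

/-- `J(h)(s) = ∫_0^s (t/s)^(N-1) h(t) dt`, with `J(h)(0) = 0`. -/
def Jmap (N : ℕ) (h : ℝ → ℝ) (s : ℝ) : ℝ :=
  if s = 0 then 0 else ∫ t in (0:ℝ)..s, (t / s) ^ (N - 1) * h t

/-- `S_p(h)(r) = ∫_r^1 φ_{p'}(J(h)(s)) ds` where `p' = p/(p-1)`. -/
def Sp (p : ℝ) (N : ℕ) (h : ℝ → ℝ) (r : ℝ) : ℝ :=
  ∫ s in r..(1:ℝ), phi (p / (p - 1)) (Jmap N h s)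

/-- The sup norm over `[0,1]`. -/
def norm0 (h : ℝ → ℝ) : ℝ := sSup ((fun t => |h t|) '' Set.Icc 0 1)

/-- `u` is not identically zero on `[0,1]`. -/
def Nontriv01 (u : ℝ → ℝ) : Prop := ∃ r ∈ Set.Icc (0:ℝ) 1, u r ≠ 0

/-- `(lam, u)` is a solution of problem (P):
`-(r^(N-1) φ_p(u'))' = lam r^(N-1) f(r, u(r))` on `(0,1)`, `u'(0) = u(1) = 0`. -/
def IsSolutionP (p : ℝ) (N : ℕ) (f : ℝ → ℝ → ℝ) (lam : ℝ) (u : ℝ → ℝ) : Prop :=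
  C1on01 u ∧ C1on01 (fun r => phi p (deriv01 u r)) ∧
  (∀ r ∈ Set.Ioo (0:ℝ) 1,
      HasDerivAt (fun s => s ^ (N - 1) * phi p (deriv01 u s))
        (-(lam * r ^ (N - 1) * f r (u r))) r) ∧
  deriv01 u 0 = 0 ∧ u 1 = 0

/-- `(lam, v)` is a principal eigenpair for the weight `w`. -/
def IsPrincipalEigenpair (p : ℝ) (N : ℕ) (w : ℝ → ℝ) (lam : ℝ) (v : ℝ → ℝ) : Prop :=
  0 < lam ∧ C1on01 v ∧ C1on01 (fun r => phi p (deriv01 v r)) ∧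
  (∀ r ∈ Set.Ico (0:ℝ) 1, 0 < v r) ∧
  (∀ r ∈ Set.Ioo (0:ℝ) 1,
      HasDerivAt (fun s => s ^ (N - 1) * phi p (deriv01 v s))
        (-(lam * r ^ (N - 1) * w r * phi p (v r))) r) ∧
  deriv01 v 0 = 0 ∧ v 1 = 0


theorem HasDerivWithinAt.isTheta_sub_nhdsWithin {f : ℝ → ℝ} {d x : ℝ} {s : Set ℝ}
    (hf : HasDerivWithinAt f d s x) (hd : d ≠ 0) :
    (fun y => f y - f x) =Θ[𝓝[s] x] fun y => y - x := by
  have ht : Tendsto (fun y : ℝ => (y, x)) (𝓝[s] x) (𝓝[s] x ×ˢ pure x) :=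
    tendsto_id.prodMk tendsto_const_pure
  have h := HasDerivAtFilter.isTheta_sub hf hd
  exact ⟨h.1.comp_tendsto ht, h.2.comp_tendsto ht⟩

theorem intervalIntegrable_abs_rpow {r : ℝ} (hr : -1 < r) (a b : ℝ) :
    IntervalIntegrable (fun x : ℝ => |x| ^ r) volume a b := by
  have h0 : ∀ t, 0 < t → IntervalIntegrable (fun x : ℝ => |x| ^ r) volume 0 t := by
    intro t ht
    refine (intervalIntegrable_rpow' (a := 0) (b := t) hr).congr fun x hx => ?_
    rw [uIoc_of_le ht.le] at hx
    simp only [abs_of_pos hx.1]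
  exact intervalIntegrable_of_even (fun x => by simp only [abs_neg]) h0

theorem integrableAtFilter_abs_sub_rpow {r : ℝ} (hr : -1 < r) (x : ℝ) (s : Set ℝ) :
    IntegrableAtFilter (fun y => |y - x| ^ r) (𝓝[s] x) := by
  have h1 : IntervalIntegrable (fun y => |y - x| ^ r) volume (-1 + x) (1 + x) :=
    (intervalIntegrable_abs_rpow hr (-1) 1).comp_sub_right x
  rw [intervalIntegrable_iff_integrableOn_Ioo_of_le (by linarith)] at h1
  exact ⟨_, mem_nhdsWithin_of_mem_nhds (Ioo_mem_nhds (by linarith) (by linarith)), h1⟩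

/-- A negative power of exponent above `-1` of a function with only simple zeros is integrable. -/
theorem integrableOn_abs_rpow_of_simple_zeros {J : ℝ → ℝ} {a b r : ℝ}
    (hJ : ContinuousOn J (Icc a b))
    (hz : ∀ x ∈ Icc a b, J x = 0 → ∃ d ≠ 0, HasDerivWithinAt J d (Icc a b) x)
    (hr : -1 < r) (hr0 : r < 0) :
    IntegrableOn (fun s => |J s| ^ r) (Icc a b) := by
  refine LocallyIntegrableOn.integrableOn_isCompact (fun x hx => ?_) isCompact_Icc
  have hmeas : StronglyMeasurableAtFilter (fun s => |J s| ^ r) (𝓝[Icc a b] x) :=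
    ⟨Icc a b, self_mem_nhdsWithin,
      (((hJ.abs).aemeasurable measurableSet_Icc).pow_const r).aestronglyMeasurable⟩
  by_cases h0 : J x = 0
  · obtain ⟨d, hd, hder⟩ := hz x hx h0
    refine Asymptotics.IsBigO.integrableAtFilter ?_ hmeas
      (integrableAtFilter_abs_sub_rpow hr x (Icc a b))
    obtain ⟨c, hc, hb⟩ := (hder.isTheta_sub_nhdsWithin hd).2.exists_pos
    rw [Asymptotics.isBigOWith_iff] at hb
    refine Asymptotics.IsBigO.of_bound ((c⁻¹) ^ r) ?_
    filter_upwards [hb] with y hy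
    rw [h0, sub_zero, Real.norm_eq_abs, Real.norm_eq_abs] at hy
    rw [Real.norm_of_nonneg (by positivity), Real.norm_of_nonneg (by positivity)]
    rcases eq_or_ne y x with rfl | hne
    · simp [h0, Real.zero_rpow hr0.ne]
    · rw [← Real.mul_rpow (by positivity) (by positivity)]
      have hpos : 0 < |y - x| := abs_pos.2 (sub_ne_zero.2 hne)
      refine Real.rpow_le_rpow_of_nonpos (by positivity) ?_ hr0.le
      rw [inv_mul_le_iff₀ hc]
      exact hy
  · have hc : ContinuousWithinAt (fun s => |J s| ^ r) (Icc a b) x :=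
      (hJ x hx).abs.rpow_const (Or.inl (abs_ne_zero.2 h0))
    refine Asymptotics.IsBigO.integrableAtFilter (g := fun _ => (1 : ℝ))
      (hc.isBigO_one ℝ) hmeas ?_
    exact continuousOn_const.integrableAt_nhdsWithin measurableSet_Icc hx

theorem hasDerivWithinAt_integral_left {f : ℝ → ℝ} {r : ℝ} (hf : IntegrableOn f (Icc 0 1))
    (hr : r ∈ Icc (0 : ℝ) 1) (hc : ContinuousWithinAt f (Icc 0 1) r) :
    HasDerivWithinAt (fun x => ∫ s in x..(1 : ℝ), f s) (-f r) (Icc 0 1) r := by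
  have : Fact (r ∈ Icc (0 : ℝ) 1) := ⟨hr⟩
  refine integral_hasDerivWithinAt_left (t := Icc 0 1) ?_
    ⟨_, self_mem_nhdsWithin, hf.aestronglyMeasurable⟩ hc
  rw [intervalIntegrable_iff_integrableOn_Icc_of_le hr.2]
  exact hf.mono_set (Icc_subset_Icc_left hr.1)

theorem hasDerivWithinAt_integral_right {f : ℝ → ℝ} {r : ℝ} (hf : ContinuousOn f (Icc 0 1))
    (hr : r ∈ Icc (0 : ℝ) 1) :
    HasDerivWithinAt (fun x => ∫ s in (0 : ℝ)..x, f s) (f r) (Icc 0 1) r := by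
  have : Fact (r ∈ Icc (0 : ℝ) 1) := ⟨hr⟩
  have hi : IntegrableOn f (Icc 0 1) := hf.integrableOn_Icc
  refine integral_hasDerivWithinAt_right (t := Icc 0 1) ?_
    ⟨_, self_mem_nhdsWithin, hi.aestronglyMeasurable⟩ (hf r hr)
  rw [intervalIntegrable_iff_integrableOn_Icc_of_le hr.1]
  exact hi.mono_set (Icc_subset_Icc_right hr.2)

theorem Jmap_of_ne_zero (N : ℕ) (h : ℝ → ℝ) {s : ℝ} (hs : s ≠ 0) :
    Jmap N h s = (s ^ (N - 1))⁻¹ * ∫ t in (0 : ℝ)..s, t ^ (N - 1) * h t := by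
  rw [Jmap, if_neg hs, ← intervalIntegral.integral_const_mul]
  congr 1 with t
  rw [div_pow]
  ring

theorem continuousOn_pow_mul {h : ℝ → ℝ} (hh : ContinuousOn h (Icc 0 1)) (n : ℕ) :
    ContinuousOn (fun t => t ^ n * h t) (Icc 0 1) :=
  (continuousOn_pow n).mul hh

theorem hasDerivWithinAt_Jmap_of_pos (N : ℕ) {h : ℝ → ℝ} (hh : ContinuousOn h (Icc 0 1)) {s : ℝ}
    (hs : s ∈ Ioc (0 : ℝ) 1) :
    HasDerivWithinAt (Jmap N h) (h s - (N - 1 : ℕ) / s * Jmap N h s) (Icc 0 1) s := by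
  have hs0 : s ≠ 0 := hs.1.ne'
  have h1 := hasDerivWithinAt_integral_right (continuousOn_pow_mul hh (N - 1))
    (Ioc_subset_Icc_self hs)
  have h2 : HasDerivWithinAt (fun x : ℝ => (x ^ (N - 1))⁻¹)
      (-((N - 1 : ℕ) * s ^ (N - 1 - 1)) / (s ^ (N - 1)) ^ 2) (Icc 0 1) s :=
    (hasDerivAt_pow (N - 1) s).hasDerivWithinAt.fun_inv (pow_ne_zero _ hs0)
  have h3 := h2.fun_mul h1
  have h4 : HasDerivWithinAt (Jmap N h) _ (Icc 0 1) s := h3.congr_of_eventuallyEq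
    (by
      filter_upwards [mem_nhdsWithin_of_mem_nhds (Ioi_mem_nhds hs.1)] with x hx
      exact Jmap_of_ne_zero N h (ne_of_gt hx))
    (Jmap_of_ne_zero N h hs0)
  convert h4 using 1
  rw [Jmap_of_ne_zero N h hs0]
  rcases Nat.eq_zero_or_pos (N - 1) with hn | hn
  · simp [hn]
  · obtain ⟨m, hm⟩ := Nat.exists_eq_succ_of_ne_zero hn.ne'
    rw [hm]
    simp only [Nat.succ_eq_add_one, Nat.add_sub_cancel]
    field_simp
    ring

theorem hasDerivWithinAt_Jmap_zero {N : ℕ} (hN : 1 ≤ N) {h : ℝ → ℝ}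
    (hh : ContinuousOn h (Icc 0 1)) :
    HasDerivWithinAt (Jmap N h) (h 0 / N) (Icc 0 1) 0 := by
  rw [hasDerivWithinAt_iff_isLittleO, Asymptotics.isLittleO_iff]
  intro ε hε
  obtain ⟨δ, hδ, hd⟩ := Metric.continuousWithinAt_iff.1 (hh 0 (by simp)) ε hε
  filter_upwards [self_mem_nhdsWithin, mem_nhdsWithin_of_mem_nhds (Iio_mem_nhds hδ)] with s hs hsδ
  rw [mem_Iio] at hsδ
  rcases eq_or_lt_of_le hs.1 with rfl | hs0
  · simp
  have hsub : uIcc 0 s ⊆ Icc 0 1 := by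
    rw [uIcc_of_le hs.1]; exact Icc_subset_Icc_right hs.2
  have hpow : ∫ t in (0 : ℝ)..s, (t / s) ^ (N - 1) * h 0 = s * (h 0 / N) := by
    have h1 : ∀ t : ℝ, (t / s) ^ (N - 1) * h 0 = (h 0 / s ^ (N - 1)) * t ^ (N - 1) := fun t => by
      rw [div_pow]; ring
    simp_rw [h1]
    rw [intervalIntegral.integral_const_mul, integral_pow]
    obtain ⟨m, rfl⟩ := Nat.exists_eq_add_of_le' hN
    simp only [Nat.add_sub_cancel]
    push_cast
    field_simp
    simp only [ne_eq, Nat.add_eq_zero_iff, one_ne_zero, and_false, not_false_eq_true, zero_pow,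
      sub_zero]
    ring
  have hJ : Jmap N h s - Jmap N h 0 - (s - 0) • (h 0 / N)
      = ∫ t in (0 : ℝ)..s, (t / s) ^ (N - 1) * (h t - h 0) := by
    rw [sub_zero, smul_eq_mul, ← hpow, Jmap, Jmap, if_neg hs0.ne', if_pos rfl, sub_zero,
      ← intervalIntegral.integral_sub]
    · simp only [mul_sub]
    · exact ContinuousOn.intervalIntegrable
        (((continuous_id.div_const s).pow (N - 1)).continuousOn.mul (hh.mono hsub))
    · exact Continuous.intervalIntegrable (by fun_prop) _ _
  rw [hJ]
  have hb := norm_integral_le_of_norm_le_const (a := 0) (b := s) (C := ε)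
    (f := fun t => (t / s) ^ (N - 1) * (h t - h 0)) ?_
  · rwa [← Real.norm_eq_abs] at hb
  intro t ht
  rw [uIoc_of_le hs.1] at ht
  have ht1 : ‖(t / s) ^ (N - 1)‖ ≤ 1 := by
    have hq : 0 ≤ t / s := div_nonneg ht.1.le hs.1
    rw [Real.norm_of_nonneg (by positivity)]
    exact pow_le_one₀ hq ((div_le_one hs0).2 ht.2)
  have ht2 : ‖h t - h 0‖ ≤ ε := by
    rw [← dist_eq_norm]
    refine (hd ⟨ht.1.le, ht.2.trans hs.2⟩ ?_).le
    rw [Real.dist_eq, sub_zero, abs_of_pos ht.1]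
    exact ht.2.trans_lt hsδ
  rw [norm_mul]
  calc _ ≤ 1 * ε := mul_le_mul ht1 ht2 (norm_nonneg _) zero_le_one
    _ = ε := one_mul ε

theorem continuousOn_Jmap {N : ℕ} (hN : 1 ≤ N) {h : ℝ → ℝ} (hh : ContinuousOn h (Icc 0 1)) :
    ContinuousOn (Jmap N h) (Icc 0 1) := by
  intro s hs
  rcases eq_or_lt_of_le hs.1 with rfl | hs0
  · exact (hasDerivWithinAt_Jmap_zero hN hh).continuousWithinAt
  · exact (hasDerivWithinAt_Jmap_of_pos N hh ⟨hs0, hs.2⟩).continuousWithinAt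

theorem abs_phi {q : ℝ} (hq : q ≠ 1) (x : ℝ) : |phi q x| = |x| ^ (q - 1) := by
  rcases eq_or_ne x 0 with rfl | hx
  · simp [phi, Real.zero_rpow (sub_ne_zero.2 hq)]
  · have h0 : 0 < |x| := abs_pos.2 hx
    rw [phi, abs_mul, abs_of_nonneg (by positivity), ← Real.rpow_add_one h0.ne']
    ring_nf

theorem continuous_phi {q : ℝ} (hq : 1 < q) : Continuous (phi q) := by
  rw [continuous_iff_continuousAt]
  intro x
  rcases eq_or_ne x 0 with rfl | hx
  · rw [ContinuousAt, show phi q 0 = 0 by simp [phi]]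
    rw [tendsto_zero_iff_abs_tendsto_zero]
    have h1 : Continuous fun x : ℝ => |x| ^ (q - 1) :=
      continuous_abs.rpow_const fun _ => Or.inr (by linarith)
    have h2 := h1.tendsto 0
    simp only [abs_zero, Real.zero_rpow (sub_ne_zero.2 hq.ne')] at h2
    exact h2.congr fun x => (abs_phi hq.ne' x).symm
  · exact (continuousAt_id.abs.rpow_const (Or.inl (abs_ne_zero.2 hx))).mul continuousAt_id

theorem uniqueDiffWithinAt_Icc01 {r : ℝ} (hr : r ∈ Icc (0 : ℝ) 1) :
    UniqueDiffWithinAt ℝ (Icc (0 : ℝ) 1) r :=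
  uniqueDiffOn_Icc zero_lt_one r hr

theorem deriv01_Sp {p : ℝ} (hp : 1 < p) {N : ℕ} (hN : 1 ≤ N) {h : ℝ → ℝ}
    (hh : ContinuousOn h (Icc 0 1)) {r : ℝ} (hr : r ∈ Icc (0 : ℝ) 1) :
    deriv01 (Sp p N h) r = -phi (p / (p - 1)) (Jmap N h r) := by
  have hq : 1 < p / (p - 1) := by rw [lt_div_iff₀ (by linarith)]; linarith
  have hc : ContinuousOn (fun s => phi (p / (p - 1)) (Jmap N h s)) (Icc 0 1) :=
    (continuous_phi hq).comp_continuousOn (continuousOn_Jmap hN hh)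
  exact (hasDerivWithinAt_integral_left hc.integrableOn_Icc hr (hc r hr)).derivWithin
    (uniqueDiffWithinAt_Icc01 hr)

theorem abs_deriv01_Sp {p : ℝ} (hp : 1 < p) {N : ℕ} (hN : 1 ≤ N) {h : ℝ → ℝ}
    (hh : ContinuousOn h (Icc 0 1)) {r : ℝ} (hr : r ∈ Icc (0 : ℝ) 1) :
    |deriv01 (Sp p N h) r| = |Jmap N h r| ^ (1 / (p - 1)) := by
  have hq : 1 < p / (p - 1) := by rw [lt_div_iff₀ (by linarith)]; linarith
  have hp1 : p - 1 ≠ 0 := by linarith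
  rw [deriv01_Sp hp hN hh hr, abs_neg, abs_phi hq.ne']
  congr 1
  field_simp
  ring

theorem deriv01_Sp_eq_zero_iff {p : ℝ} (hp : 1 < p) {N : ℕ} (hN : 1 ≤ N) {h : ℝ → ℝ}
    (hh : ContinuousOn h (Icc 0 1)) {r : ℝ} (hr : r ∈ Icc (0 : ℝ) 1) :
    deriv01 (Sp p N h) r = 0 ↔ Jmap N h r = 0 := by
  rw [← abs_eq_zero, abs_deriv01_Sp hp hN hh hr, Real.rpow_eq_zero (abs_nonneg _), abs_eq_zero]
  have : p - 1 ≠ 0 := by linarith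
  positivity

theorem abs_deriv01_Sp_rpow {p : ℝ} (hp : 1 < p) {N : ℕ} (hN : 1 ≤ N) {h : ℝ → ℝ}
    (hh : ContinuousOn h (Icc 0 1)) {r : ℝ} (hr : r ∈ Icc (0 : ℝ) 1) (q : ℝ) :
    |deriv01 (Sp p N h) r| ^ q = |Jmap N h r| ^ (q / (p - 1)) := by
  rw [abs_deriv01_Sp hp hN hh hr, ← Real.rpow_mul (abs_nonneg _)]
  congr 1
  ring

theorem exists_hasDerivWithinAt_Jmap {N : ℕ} (hN : 1 ≤ N) {h : ℝ → ℝ}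
    (hh : ContinuousOn h (Icc 0 1)) {r : ℝ} (hr : r ∈ Icc (0 : ℝ) 1) (hJ : Jmap N h r = 0)
    (hr0 : h r ≠ 0) : ∃ d ≠ 0, HasDerivWithinAt (Jmap N h) d (Icc 0 1) r := by
  rcases eq_or_lt_of_le hr.1 with rfl | hs0
  · exact ⟨_, div_ne_zero hr0 (by positivity), hasDerivWithinAt_Jmap_zero hN hh⟩
  · exact ⟨_, by rwa [hJ, mul_zero, sub_zero], hasDerivWithinAt_Jmap_of_pos N hh ⟨hs0, hr.2⟩⟩

/-- Near `0` the quotient of `|J(hbar)|` by a power of `|J(h)|` is controlled by a power of `r`. -/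
theorem exists_abs_Jmap_rpow_mul_le {N : ℕ} (hN : 1 ≤ N) {h hbar : ℝ → ℝ}
    (hh : ContinuousOn h (Icc 0 1)) (hhbar : ContinuousOn hbar (Icc 0 1)) (h0 : h 0 ≠ 0)
    {q : ℝ} (hq : q ≤ 0) :
    ∃ ρ > 0, ρ ≤ 1 ∧ ∃ C > 0, ∀ r ∈ Ioc (0 : ℝ) ρ, Jmap N h r ≠ 0 ∧
      |Jmap N h r| ^ q * |Jmap N hbar r| ≤ C * r ^ (q + 1) := by
  have hJ0 : ∀ k : ℝ → ℝ, Jmap N k 0 = 0 := fun k => if_pos rfl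
  have hd : h 0 / N ≠ 0 := div_ne_zero h0 (by positivity)
  obtain ⟨c₁, hc₁, hb₁⟩ :=
    ((hasDerivWithinAt_Jmap_zero hN hh).isTheta_sub_nhdsWithin hd).2.exists_pos
  obtain ⟨c₂, hc₂, hb₂⟩ :=
    (hasDerivWithinAt_Jmap_zero hN hhbar).differentiableWithinAt.isBigO_sub.exists_pos
  rw [Asymptotics.isBigOWith_iff] at hb₁ hb₂
  obtain ⟨ε, hε, hball⟩ := Metric.mem_nhdsWithin_iff.1 (hb₁.and hb₂)
  refine ⟨min (ε / 2) 1, by positivity, min_le_right _ _, c₁⁻¹ ^ q * c₂, by positivity, ?_⟩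
  intro r hr
  have hr1 : r ≤ ε / 2 := hr.2.trans (min_le_left _ _)
  have hr2 : r ≤ 1 := hr.2.trans (min_le_right _ _)
  obtain ⟨h1, h2⟩ := hball (show r ∈ Metric.ball 0 ε ∩ Icc 0 1 from
    ⟨by rw [mem_ball_zero_iff, Real.norm_of_nonneg hr.1.le]; linarith, hr.1.le, hr2⟩)
  simp only [hJ0, sub_zero, Real.norm_eq_abs, abs_of_pos hr.1] at h1 h2
  have h3 : c₁⁻¹ * r ≤ |Jmap N h r| := by rwa [inv_mul_le_iff₀ hc₁]
  have h4 : 0 < c₁⁻¹ * r := mul_pos (inv_pos.2 hc₁) hr.1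
  refine ⟨abs_pos.1 (h4.trans_le h3), ?_⟩
  calc |Jmap N h r| ^ q * |Jmap N hbar r|
      ≤ (c₁⁻¹ * r) ^ q * (c₂ * r) :=
        mul_le_mul (Real.rpow_le_rpow_of_nonpos h4 h3 hq) h2 (abs_nonneg _) (by positivity)
    _ = c₁⁻¹ ^ q * c₂ * r ^ (q + 1) := by
        rw [Real.mul_rpow (by positivity) hr.1.le, Real.rpow_add_one hr.1.ne']
        ring

theorem exists_C1on01_primitive {f : ℝ → ℝ} (hf : ContinuousOn f (Icc 0 1)) :
    C1on01 (fun r => ∫ t in (0 : ℝ)..r, f t) ∧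
      ∀ r ∈ Ioo (0 : ℝ) 1, HasDerivAt (fun r => ∫ t in (0 : ℝ)..r, f t) (f r) r := by
  refine ⟨⟨fun r hr => (hasDerivWithinAt_integral_right hf hr).differentiableWithinAt, ?_⟩,
    fun r hr => (hasDerivWithinAt_integral_right hf (Ioo_subset_Icc_self hr)).hasDerivAt
      (Icc_mem_nhds hr.1 hr.2)⟩
  exact hf.congr fun r hr =>
    (hasDerivWithinAt_integral_right hf hr).derivWithin (uniqueDiffWithinAt_Icc01 hr)

/-- pointwise properties of `v(r) = p* ∫_r^1 |u'(s)|^(2-p) J(h̄)(s) ds`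
where `u = S_p(h)`: boundary value at 1, derivative formula where `u' ≠ 0`, the `C^1`
extension `w` of `r^(N-1)|u'|^(p-2) v'` solving `-w' = p* r^(N-1) h̄`, and the bound
`|v'(r)| ≤ C r^(p*)` near 0, giving `v'(0) = 0`. -/
theorem stmt_6 (p : ℝ) (hp : 2 < p) (N : ℕ) (hN : 1 ≤ N)
    (h : ℝ → ℝ) (hcont : ContinuousOn h (Set.Icc 0 1))
    (hnd : ∀ r ∈ Set.Icc (0:ℝ) 1, deriv01 (Sp p N h) r = 0 → h r ≠ 0)
    (hbar : ℝ → ℝ) (hbarcont : ContinuousOn hbar (Set.Icc 0 1)) :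
    -- u := Sp p N h, v as below
    (IntegrableOn (fun t => |deriv01 (Sp p N h) t| ^ (2 - p)) (Set.Ioo (0:ℝ) 1)) ∧
    -- (a)
    ((1 / (p - 1)) * ∫ s in (1:ℝ)..1,
        |deriv01 (Sp p N h) s| ^ (2 - p) * Jmap N hbar s) = 0 ∧
    -- (b) derivative where u' ≠ 0, and the identity for r^(N-1)|u'|^(p-2) v'
    (∀ r ∈ Set.Ioc (0:ℝ) 1, deriv01 (Sp p N h) r ≠ 0 →
      HasDerivWithinAt
        (fun x => (1 / (p - 1)) * ∫ s in x..(1:ℝ),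
          |deriv01 (Sp p N h) s| ^ (2 - p) * Jmap N hbar s)
        (-((1 / (p - 1)) * |deriv01 (Sp p N h) r| ^ (2 - p) * Jmap N hbar r))
        (Set.Icc 0 1) r ∧
      r ^ (N - 1) * |deriv01 (Sp p N h) r| ^ (p - 2) *
          (-((1 / (p - 1)) * |deriv01 (Sp p N h) r| ^ (2 - p) * Jmap N hbar r))
        = -((1 / (p - 1)) * ∫ t in (0:ℝ)..r, t ^ (N - 1) * hbar t)) ∧
    -- (b) the C¹ extension w with -w' = p* r^(N-1) h̄
    (∃ w : ℝ → ℝ, C1on01 w ∧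
      (∀ r ∈ Set.Ioc (0:ℝ) 1, deriv01 (Sp p N h) r ≠ 0 →
        w r = r ^ (N - 1) * |deriv01 (Sp p N h) r| ^ (p - 2) *
          derivWithin
            (fun x => (1 / (p - 1)) * ∫ s in x..(1:ℝ),
              |deriv01 (Sp p N h) s| ^ (2 - p) * Jmap N hbar s)
            (Set.Icc 0 1) r) ∧
      (∀ r ∈ Set.Ioo (0:ℝ) 1,
        HasDerivAt w (-((1 / (p - 1)) * r ^ (N - 1) * hbar r)) r)) ∧
    -- (c) the bound near 0 and v'(0) = 0
    (∃ ρ > 0, ρ ≤ 1 ∧ ∃ C > 0,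
      (∀ r ∈ Set.Ioc (0:ℝ) ρ, deriv01 (Sp p N h) r ≠ 0 ∧
        |derivWithin
            (fun x => (1 / (p - 1)) * ∫ s in x..(1:ℝ),
              |deriv01 (Sp p N h) s| ^ (2 - p) * Jmap N hbar s)
            (Set.Icc 0 1) r| ≤ C * r ^ (1 / (p - 1))) ∧
      HasDerivWithinAt
        (fun x => (1 / (p - 1)) * ∫ s in x..(1:ℝ),
          |deriv01 (Sp p N h) s| ^ (2 - p) * Jmap N hbar s)
        0 (Set.Icc 0 1) 0) := by
  have hp1 : 0 < p - 1 := by linarith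
  have hp1' : 1 < p := by linarith
  set q : ℝ := (2 - p) / (p - 1) with hq_def
  have hq0 : q < 0 := div_neg_of_neg_of_pos (by linarith) hp1
  have hq1 : -1 < q := by rw [hq_def, lt_div_iff₀ hp1]; linarith
  have hqp : q + 1 = 1 / (p - 1) := by rw [hq_def]; field_simp; ring
  have h01 : (0 : ℝ) ∈ Icc (0 : ℝ) 1 := by simp
  have hJ0 : ∀ k : ℝ → ℝ, Jmap N k 0 = 0 := fun k => if_pos rfl
  have hzero : ∀ r ∈ Icc (0 : ℝ) 1, deriv01 (Sp p N h) r = 0 ↔ Jmap N h r = 0 :=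
    fun r hr => deriv01_Sp_eq_zero_iff hp1' hN hcont hr
  have hJc := continuousOn_Jmap hN hcont
  have hJbc := continuousOn_Jmap hN hbarcont
  have hpow : ∀ r ∈ Icc (0 : ℝ) 1, |deriv01 (Sp p N h) r| ^ (2 - p) = |Jmap N h r| ^ q :=
    fun r hr => abs_deriv01_Sp_rpow hp1' hN hcont hr _
  have hint : IntegrableOn (fun t => |deriv01 (Sp p N h) t| ^ (2 - p)) (Icc (0 : ℝ) 1) := by
    refine (integrableOn_abs_rpow_of_simple_zeros hJc (fun x hx hx0 => ?_) hq1 hq0).congr_fun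
      (fun r hr => (hpow r hr).symm) measurableSet_Icc
    exact exists_hasDerivWithinAt_Jmap hN hcont hx hx0 (hnd x hx ((hzero x hx).2 hx0))
  set g : ℝ → ℝ := fun s => |deriv01 (Sp p N h) s| ^ (2 - p) * Jmap N hbar s with hg_def
  have hgint : IntegrableOn g (Icc 0 1) := hint.mul_continuousOn hJbc isCompact_Icc
  have hg_eq : EqOn (fun t => |Jmap N h t| ^ q * Jmap N hbar t) g (Icc 0 1) := fun r hr => by
    simp only [hg_def, hpow r hr]
  have hv : ∀ r ∈ Icc (0 : ℝ) 1, ContinuousWithinAt g (Icc 0 1) r →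
      HasDerivWithinAt (fun x => (1 / (p - 1)) * ∫ s in x..(1 : ℝ), g s)
        (-((1 / (p - 1)) * |deriv01 (Sp p N h) r| ^ (2 - p) * Jmap N hbar r)) (Icc 0 1) r := by
    intro r hr hc
    rw [mul_assoc, ← mul_neg]
    exact (hasDerivWithinAt_integral_left hgint hr hc).const_mul (1 / (p - 1))
  have hgc : ∀ r ∈ Icc (0 : ℝ) 1, deriv01 (Sp p N h) r ≠ 0 → ContinuousWithinAt g (Icc 0 1) r := by
    intro r hr hne
    have hJne : |Jmap N h r| ≠ 0 := abs_ne_zero.2 fun hh => hne ((hzero r hr).2 hh)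
    exact (((hJc r hr).abs.rpow_const (Or.inl hJne)).mul (hJbc r hr)).congr
      (fun y hy => (hg_eq hy).symm) (hg_eq hr).symm
  have hident : ∀ r ∈ Ioc (0 : ℝ) 1, deriv01 (Sp p N h) r ≠ 0 →
      r ^ (N - 1) * |deriv01 (Sp p N h) r| ^ (p - 2) *
          (-((1 / (p - 1)) * |deriv01 (Sp p N h) r| ^ (2 - p) * Jmap N hbar r))
        = -((1 / (p - 1)) * ∫ t in (0:ℝ)..r, t ^ (N - 1) * hbar t) := by
    intro r hr hne
    have hr0 : r ^ (N - 1) ≠ 0 := pow_ne_zero _ hr.1.ne'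
    have hmul : |deriv01 (Sp p N h) r| ^ (p - 2) * |deriv01 (Sp p N h) r| ^ (2 - p) = 1 := by
      rw [← Real.rpow_add (abs_pos.2 hne), sub_add_sub_cancel, sub_self, Real.rpow_zero]
    calc _ = -((1 / (p - 1)) * (|deriv01 (Sp p N h) r| ^ (p - 2) *
          |deriv01 (Sp p N h) r| ^ (2 - p)) * (r ^ (N - 1) * Jmap N hbar r)) := by ring
      _ = _ := by rw [hmul, mul_one, Jmap_of_ne_zero N hbar hr.1.ne', mul_inv_cancel_left₀ hr0]
  have hvd : ∀ r ∈ Ioc (0 : ℝ) 1, deriv01 (Sp p N h) r ≠ 0 →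
      derivWithin (fun x => (1 / (p - 1)) * ∫ s in x..(1 : ℝ), g s) (Icc 0 1) r
        = -((1 / (p - 1)) * |deriv01 (Sp p N h) r| ^ (2 - p) * Jmap N hbar r) := fun r hr hne =>
    (hv r (Ioc_subset_Icc_self hr) (hgc r (Ioc_subset_Icc_self hr) hne)).derivWithin
      (uniqueDiffWithinAt_Icc01 (Ioc_subset_Icc_self hr))
  refine ⟨hint.mono_set Ioo_subset_Icc_self, by rw [integral_same, mul_zero],
    fun r hr hne => ⟨hv r (Ioc_subset_Icc_self hr) (hgc r (Ioc_subset_Icc_self hr) hne),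
      hident r hr hne⟩, ?_, ?_⟩
  · obtain ⟨hw, hw'⟩ := exists_C1on01_primitive
      (f := fun t => -((1 / (p - 1)) * (t ^ (N - 1) * hbar t)))
      ((continuousOn_const.mul (continuousOn_pow_mul hbarcont (N - 1))).neg)
    refine ⟨_, hw, fun r hr hne => ?_, fun r hr => ?_⟩
    · rw [hvd r hr hne, hident r hr hne, intervalIntegral.integral_neg,
        intervalIntegral.integral_const_mul]
    · rw [mul_assoc]
      exact hw' r hr
  · have hh0 : h 0 ≠ 0 := hnd 0 h01 ((hzero 0 h01).2 (hJ0 h))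
    obtain ⟨ρ, hρ, hρ1, C, hC, hbound⟩ :=
      exists_abs_Jmap_rpow_mul_le hN hcont hbarcont hh0 hq0.le
    rw [hqp] at hbound
    refine ⟨ρ, hρ, hρ1, 1 / (p - 1) * C, by positivity, fun r hr => ?_, ?_⟩
    · have hr1 : r ∈ Ioc (0 : ℝ) 1 := ⟨hr.1, hr.2.trans hρ1⟩
      have hrI := Ioc_subset_Icc_self hr1
      obtain ⟨hne, hle⟩ := hbound r hr
      have hne' : deriv01 (Sp p N h) r ≠ 0 := fun hh => hne ((hzero r hrI).1 hh)
      refine ⟨hne', ?_⟩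
      rw [hvd r hr1 hne', hpow r hrI, abs_neg, mul_assoc, mul_assoc, abs_mul, abs_mul,
        abs_of_pos (by positivity : 0 < 1 / (p - 1)),
        abs_of_nonneg (by positivity : 0 ≤ |Jmap N h r| ^ q)]
      gcongr
    · have hg0 : g 0 = 0 := by simp only [hg_def, hJ0, mul_zero]
      have hc0 : ContinuousWithinAt g (Icc 0 1) 0 := by
        rw [ContinuousWithinAt, hg0]
        have hpc : Tendsto (fun r : ℝ => C * r ^ (1 / (p - 1))) (𝓝[Icc 0 1] 0) (𝓝 0) := by
          have hcont' : Continuous fun r : ℝ => C * r ^ (1 / (p - 1)) :=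
            continuous_const.mul (Real.continuous_rpow_const (by positivity))
          have ht := hcont'.tendsto 0
          simp only [Real.zero_rpow (one_div_pos.2 hp1).ne', mul_zero] at ht
          exact ht.mono_left nhdsWithin_le_nhds
        refine squeeze_zero_norm' ?_ hpc
        filter_upwards [self_mem_nhdsWithin, mem_nhdsWithin_of_mem_nhds (Iio_mem_nhds hρ)]
          with r hr hrρ
        rcases eq_or_lt_of_le hr.1 with rfl | hr0
        · rw [hg0, norm_zero]
          positivity
        · rw [← hg_eq hr, norm_mul, Real.norm_eq_abs, Real.norm_eq_abs,
            abs_of_nonneg (by positivity : 0 ≤ |Jmap N h r| ^ q)]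
          exact (hbound r ⟨hr0, le_of_lt hrρ⟩).2
      have hd := hv 0 h01 hc0
      rwa [hJ0, mul_zero, neg_zero] at hd
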